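/- Let (X,d,W) be a uniformly convex hyperbolic space with a monotone modulus of uniform convexity η, C ⊆ X a nonempty convex subset, T : C → C asymptotically nonexpansive with sequence (k_n), (λ_n) a sequence in [0,1], and (x_n) the Krasnoselski–Mann iteration starting from x ∈ C. Let p ∈ C and K ≥ k_m for all m ∈ ℕ. Assume n ∈ ℕ and α, β, β*, β̃, ν > 0 are such that d(T^n p, p) < ν ≤ 1, α ≤ d(x_n, p), d(x_n, p) ≤ β, d(x_n, p) ≤ β̃, d(x_n, p) ≤ β*, and α ≤ d(x_n, T^n x_n). Then d(x_{n+1}, p) < d(x_n, p) + k_n·β* + ν − 2α·λ_n(1−λ_n)·η((1+K)β̃ + 1, α/((1+K)β + 1)). -/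

import Mathlib

open Filter Set

section Hyperbolic

variable {X : Type*}

/-- A hyperbolic space structure: `W x y t` represents `(1-t)x ⊕ t y`. -/
structure IsWMap [MetricSpace X] (W : X → X → ℝ → X) : Prop where
  w1 : ∀ (x y z : X), ∀ t ∈ Set.Icc (0:ℝ) 1,
    dist z (W x y t) ≤ (1 - t) * dist z x + t * dist z y
  w2 : ∀ (x y : X), ∀ t ∈ Set.Icc (0:ℝ) 1, ∀ s ∈ Set.Icc (0:ℝ) 1,
    dist (W x y t) (W x y s) = |t - s| * dist x y
  w3 : ∀ (x y : X), ∀ t ∈ Set.Icc (0:ℝ) 1, W x y t = W y x (1 - t)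
  w4 : ∀ (x y z w : X), ∀ t ∈ Set.Icc (0:ℝ) 1,
    dist (W x z t) (W y w t) ≤ (1 - t) * dist x y + t * dist z w

/-- `η` is a modulus of uniform convexity for the hyperbolic space `(X, dist, W)`. -/
def IsUCModulus [MetricSpace X] (W : X → X → ℝ → X) (η : ℝ → ℝ → ℝ) : Prop :=
  (∀ r ε : ℝ, 0 < r → ε ∈ Set.Ioc (0:ℝ) 2 → η r ε ∈ Set.Ioc (0:ℝ) 1) ∧
  (∀ r ε : ℝ, ∀ a x y : X, 0 < r → ε ∈ Set.Ioc (0:ℝ) 2 →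
    dist x a ≤ r → dist y a ≤ r → ε * r ≤ dist x y →
    dist (W x y (1/2)) a ≤ (1 - η r ε) * r)

/-- The modulus `η` is monotone: nonincreasing in `r` for each fixed `ε`. -/
def MonotoneUCModulus (η : ℝ → ℝ → ℝ) : Prop :=
  ∀ ε ∈ Set.Ioc (0:ℝ) 2, ∀ r s : ℝ, 0 < r → r ≤ s → η s ε ≤ η r ε

/-- `C` is a convex subset w.r.t. the convexity map `W`. -/
def WConvex [MetricSpace X] (W : X → X → ℝ → X) (C : Set X) : Prop :=
  ∀ x ∈ C, ∀ y ∈ C, ∀ t ∈ Set.Icc (0:ℝ) 1, W x y t ∈ C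

/-- `T : C → C` is asymptotically nonexpansive with sequence `k`. -/
def AsymptoticallyNonexpansive [MetricSpace X] (C : Set X) (T : X → X) (k : ℕ → ℝ) : Prop :=
  Set.MapsTo T C C ∧ (∀ n, 0 ≤ k n) ∧
  Filter.Tendsto k Filter.atTop (nhds 0) ∧
  ∀ n : ℕ, ∀ x ∈ C, ∀ y ∈ C, dist (T^[n] x) (T^[n] y) ≤ (1 + k n) * dist x y

/-- `xseq` is the Krasnoselski–Mann iteration of `T` starting from `x`:
`x₀ = x`, `x_{n+1} = (1-λ_n) x_n ⊕ λ_n T^n x_n`. -/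
def IsKMIteration [MetricSpace X] (W : X → X → ℝ → X) (T : X → X) (lam : ℕ → ℝ)
    (x : X) (xseq : ℕ → X) : Prop :=
  xseq 0 = x ∧ ∀ n, xseq (n + 1) = W (xseq n) (T^[n] (xseq n)) (lam n)

end Hyperbolic

theorem IsWMap.dist_left {X : Type*} [MetricSpace X] {W : X → X → ℝ → X} (hW : IsWMap W)
    (x y : X) {t : ℝ} (ht : t ∈ Set.Icc (0:ℝ) 1) : dist x (W x y t) ≤ t * dist x y := by
  simpa using hW.w1 x y x t ht

theorem IsWMap.dist_right {X : Type*} [MetricSpace X] {W : X → X → ℝ → X} (hW : IsWMap W)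
    (x y : X) {t : ℝ} (ht : t ∈ Set.Icc (0:ℝ) 1) : dist y (W x y t) ≤ (1 - t) * dist x y := by
  simpa [dist_comm y x] using hW.w1 x y y t ht

/-- Uniform convexity forces the point dividing a segment in a given ratio to be unique. -/
theorem IsUCModulus.eq_of_dist_le {X : Type*} [MetricSpace X] {W : X → X → ℝ → X}
    {η : ℝ → ℝ → ℝ} (hW : IsWMap W) (hUC : IsUCModulus W η) {x y z w : X} {r s : ℝ}
    (hrs : r + s ≤ dist x y) (hzx : dist x z ≤ r) (hzy : dist y z ≤ s)
    (hwx : dist x w ≤ r) (hwy : dist y w ≤ s) : z = w := by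
  by_contra hne
  have hd : 0 < dist z w := dist_pos.mpr hne
  have htri : dist z w ≤ 2 * r := by linarith [dist_triangle_left z w x]
  have hr : 0 < r := by linarith
  have hε : dist z w / r ∈ Set.Ioc (0:ℝ) 2 := ⟨by positivity, by rwa [div_le_iff₀ hr]⟩
  have hη := (hUC.1 r _ hr hε).1
  have hm := hUC.2 r (dist z w / r) x z w hr hε (by rwa [dist_comm]) (by rwa [dist_comm])
    (by rw [div_mul_cancel₀ _ hr.ne'])
  have hm' := hW.w1 z w y (1 / 2) (by norm_num)
  have := dist_triangle x (W z w (1 / 2)) y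
  rw [dist_comm (W z w (1 / 2)) y, dist_comm x (W z w (1 / 2))] at this
  nlinarith [mul_pos hη hr]

theorem IsUCModulus.midpoint_reparam {X : Type*} [MetricSpace X] {W : X → X → ℝ → X}
    {η : ℝ → ℝ → ℝ} (hW : IsWMap W) (hUC : IsUCModulus W η) (x y : X) {t : ℝ}
    (h0 : 0 ≤ t) (h1 : t ≤ 1 / 2) : W x y t = W x (W x y (1 / 2)) (2 * t) := by
  have ht : t ∈ Set.Icc (0:ℝ) 1 := ⟨h0, by linarith⟩
  have h2t : 2 * t ∈ Set.Icc (0:ℝ) 1 := ⟨by linarith, by linarith⟩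
  have hhalf : (1 / 2 : ℝ) ∈ Set.Icc (0:ℝ) 1 := by norm_num
  refine hUC.eq_of_dist_le hW (r := t * dist x y) (s := (1 - t) * dist x y) (by linarith)
    (hW.dist_left x y ht) (hW.dist_right x y ht) ?_ ?_
  · have := hW.dist_left x (W x y (1 / 2)) h2t
    nlinarith [mul_le_mul_of_nonneg_left (hW.dist_left x y hhalf) h2t.1]
  · have := hW.w1 x (W x y (1 / 2)) y (2 * t) h2t
    rw [dist_comm y x] at this
    nlinarith [mul_le_mul_of_nonneg_left (hW.dist_right x y hhalf) h2t.1]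

/-- Uniform convexity at arbitrary convex combinations, from uniform convexity at midpoints. -/
theorem IsUCModulus.dist_le {X : Type*} [MetricSpace X] {W : X → X → ℝ → X}
    {η : ℝ → ℝ → ℝ} (hW : IsWMap W) (hUC : IsUCModulus W η) {a x y : X} {r ε t : ℝ}
    (hr : 0 < r) (hε : ε ∈ Set.Ioc (0:ℝ) 2) (hxa : dist x a ≤ r) (hya : dist y a ≤ r)
    (hxy : ε * r ≤ dist x y) (ht : t ∈ Set.Icc (0:ℝ) 1) :
    dist (W x y t) a ≤ (1 - 2 * t * (1 - t) * η r ε) * r := by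
  wlog hle : t ≤ 1 / 2 generalizing x y t
  · rw [hW.w3 x y t ht]
    have := this (t := 1 - t) hya hxa (by rwa [dist_comm])
      ⟨by linarith [ht.2], by linarith [ht.1]⟩ (by linarith)
    linarith
  have hη := (hUC.1 r ε hr hε).1
  have h2t : 2 * t ∈ Set.Icc (0:ℝ) 1 := ⟨by linarith [ht.1], by linarith⟩
  have hm := hUC.2 r ε a x y hr hε hxa hya hxy
  have hc := hW.w1 x (W x y (1 / 2)) a (2 * t) h2t
  rw [← hUC.midpoint_reparam hW x y ht.1 hle, dist_comm a, dist_comm a, dist_comm a] at hc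
  have e1 := mul_le_mul_of_nonneg_left hm h2t.1
  have e2 := mul_le_mul_of_nonneg_left hxa (sub_nonneg.mpr h2t.2)
  have e3 : 0 ≤ t * t * (η r ε * r) := mul_nonneg (mul_self_nonneg t) (mul_pos hη hr).le
  linarith

theorem IsKMIteration.mem {X : Type*} [MetricSpace X] {W : X → X → ℝ → X} {C : Set X}
    {T : X → X} {lam : ℕ → ℝ} {x : X} {xseq : ℕ → X} (hKM : IsKMIteration W T lam x xseq)
    (hconv : WConvex W C) (hT : Set.MapsTo T C C) (hlam : ∀ m, lam m ∈ Set.Icc (0:ℝ) 1)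
    (hx : x ∈ C) (n : ℕ) : xseq n ∈ C := by
  induction n with
  | zero => rwa [hKM.1]
  | succ m ih =>
    rw [hKM.2]
    exact hconv _ ih _ (hT.iterate m ih) _ (hlam m)

/-- (Lemma 6.2, first inequality) main technical lemma. -/
theorem main_technical_lemma
    {X : Type*} [MetricSpace X]
    (W : X → X → ℝ → X) (η : ℝ → ℝ → ℝ)
    (hW : IsWMap W) (hUC : IsUCModulus W η) (hMon : MonotoneUCModulus η)
    (C : Set X) (hne : C.Nonempty) (hconv : WConvex W C)
    (T : X → X) (k : ℕ → ℝ) (hT : AsymptoticallyNonexpansive C T k)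
    (lam : ℕ → ℝ) (hlam : ∀ m, lam m ∈ Set.Icc (0:ℝ) 1)
    (x : X) (hx : x ∈ C) (xseq : ℕ → X) (hKM : IsKMIteration W T lam x xseq)
    (p : X) (hp : p ∈ C) (K : ℝ) (hK : ∀ m, k m ≤ K)
    (n : ℕ) (α β βs βt ν : ℝ)
    (hα : 0 < α) (hβ : 0 < β) (hβs : 0 < βs) (hβt : 0 < βt) (hν : 0 < ν)
    (hTnp : dist (T^[n] p) p < ν) (hν1 : ν ≤ 1)
    (h1 : α ≤ dist (xseq n) p)
    (h2 : dist (xseq n) p ≤ β) (h3 : dist (xseq n) p ≤ βt) (h4 : dist (xseq n) p ≤ βs)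
    (h5 : α ≤ dist (xseq n) (T^[n] (xseq n))) :
    dist (xseq (n + 1)) p <
      dist (xseq n) p + k n * βs + ν -
        2 * α * lam n * (1 - lam n) * η ((1 + K) * βt + 1) (α / ((1 + K) * β + 1)) := by
  have hxn := hKM.mem hconv hT.1 hlam hx n
  have hk0 := hT.2.1 n
  have hkK := hK n
  have hTn := hT.2.2.2 n _ hxn p hp
  have htri := dist_triangle (T^[n] (xseq n)) (T^[n] p) p
  have hTp : 0 ≤ dist (T^[n] p) p := dist_nonneg
  rw [hKM.2]
  set D := dist (xseq n) p
  set r := (1 + k n) * D + dist (T^[n] p) p with hr_def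
  have hD : 0 < D := hα.trans_le h1
  have hkD : 0 ≤ k n * D := by positivity
  have hDr : D ≤ r := by linarith
  have hr : 0 < r := hD.trans_le hDr
  have hr_le : ∀ b, D ≤ b → r ≤ (1 + K) * b + 1 := fun b hb => by
    have : (1 + k n) * D ≤ (1 + K) * b := by gcongr; linarith
    linarith
  have hden : 0 < (1 + K) * β + 1 := hr.trans_le (hr_le β h2)
  have hε : α / ((1 + K) * β + 1) ∈ Set.Ioc (0:ℝ) 2 :=
    ⟨by positivity, by rw [div_le_iff₀ hden]; linarith [hr_le β h2]⟩
  have hεr : α / ((1 + K) * β + 1) * r ≤ α := by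
    rw [div_mul_eq_mul_div, div_le_iff₀ hden]
    exact mul_le_mul_of_nonneg_left (hr_le β h2) hα.le
  have hmain := hUC.dist_le hW hr hε hDr (by linarith) (hεr.trans h5) (hlam n)
  have hmono := hMon _ hε r _ hr (hr_le βt h3)
  have hηr := (hUC.1 r _ hr hε).1
  have hprod : α * η ((1 + K) * βt + 1) (α / ((1 + K) * β + 1)) ≤
      r * η r (α / ((1 + K) * β + 1)) :=
    (mul_le_mul_of_nonneg_left hmono hα.le).trans
      (mul_le_mul_of_nonneg_right (h1.trans hDr) hηr.le)
  have hlam' : 0 ≤ 2 * (lam n * (1 - lam n)) :=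
    mul_nonneg zero_le_two (mul_nonneg (hlam n).1 (sub_nonneg.mpr (hlam n).2))
  have hscaled := mul_le_mul_of_nonneg_left hprod hlam'
  have hkβ := mul_le_mul_of_nonneg_left h4 hk0
  linarith
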